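/- arXiv:1605.03683 — 3 statements merged into one kernel-verified Lean document; each statement's English description precedes it below -/
import Mathlib

section
/- Let θ > 0, x ≥ 0, and let a : [0,θ] → [0,∞) be bounded and Lebesgue measurable with ∫₀^θ a(s) ds ≤ x. Then ∫₀^θ a(τ)·exp(μτ − ∫₀^τ g(a(s)) ds) dτ ≤ (1 − e^{−h(ν)·x})/h(ν). -/
open Set AbsolutelyContinuousOnInterval in
/-- A Lipschitz function composed with an absolutely continuous one is absolutely continuous. -/
theorem LipschitzOnWith.comp_absolutelyContinuousOnInterval {X Y : Type*}
    [PseudoMetricSpace X] [PseudoMetricSpace Y] {f : X → Y} {u : ℝ → X} {K : NNReal}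
    {S : Set X} {a b : ℝ} (hf : LipschitzOnWith K f S) (hu : AbsolutelyContinuousOnInterval u a b)
    (hS : MapsTo u (uIcc a b) S) :
    AbsolutelyContinuousOnInterval (fun t ↦ f (u t)) a b := by
  rw [absolutelyContinuousOnInterval_iff] at hu ⊢
  intro ε hε
  obtain ⟨δ, hδ, H⟩ := hu (ε / (K + 1)) (by positivity)
  refine ⟨δ, hδ, fun E hE hlen ↦ ?_⟩
  have hmem : ∀ i ∈ Finset.range E.1, (E.2 i).1 ∈ uIcc a b ∧ (E.2 i).2 ∈ uIcc a b := hE.1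
  calc ∑ i ∈ Finset.range E.1, dist (f (u (E.2 i).1)) (f (u (E.2 i).2))
      ≤ ∑ i ∈ Finset.range E.1, K * dist (u (E.2 i).1) (u (E.2 i).2) :=
        Finset.sum_le_sum fun i hi ↦
          hf.dist_le_mul _ (hS (hmem i hi).1) _ (hS (hmem i hi).2)
    _ = K * ∑ i ∈ Finset.range E.1, dist (u (E.2 i).1) (u (E.2 i).2) := by rw [Finset.mul_sum]
    _ ≤ K * (ε / (K + 1)) := by gcongr; exact (H E hE hlen).le
    _ < (K + 1) * (ε / (K + 1)) := by gcongr; linarith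
    _ = ε := by field_simp

open Set MeasureTheory in
/-- The integral of `f * exp (-k * F)` for an indefinite integral `F` of `f`. -/
theorem IntervalIntegrable.integral_mul_exp_neg_integral {f : ℝ → ℝ} {a b k : ℝ} (hk : k ≠ 0)
    (hf : IntervalIntegrable f volume a b) :
    ∫ τ in a..b, f τ * Real.exp (-k * ∫ s in a..τ, f s) =
      (1 - Real.exp (-k * ∫ s in a..b, f s)) / k := by
  have hA : AbsolutelyContinuousOnInterval (fun τ ↦ ∫ s in a..τ, f s) a b :=
    hf.absolutelyContinuousOnInterval_intervalIntegral left_mem_uIcc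
  obtain ⟨M, hM⟩ := hA.exists_bound
  obtain ⟨K, hK⟩ := ContDiffOn.exists_lipschitzOnWith
    (f := fun y : ℝ ↦ Real.exp (-k * y)) (s := Icc (-M) M) (n := 1)
    (by fun_prop) (by decide) (convex_Icc _ _) isCompact_Icc
  have hE := hK.comp_absolutelyContinuousOnInterval hA fun τ hτ ↦ abs_le.1 (hM τ hτ)
  have hderiv := hE.integral_deriv_eq_sub
  have hcongr : ∫ τ in a..b, deriv (fun τ ↦ Real.exp (-k * ∫ s in a..τ, f s)) τ =
      ∫ τ in a..b, -k * (f τ * Real.exp (-k * ∫ s in a..τ, f s)) := by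
    refine intervalIntegral.integral_congr_ae ?_
    filter_upwards [hf.ae_hasDerivAt_integral] with τ hτ hmem
    rw [((hτ (uIoc_subset_uIcc hmem) a left_mem_uIcc).const_mul (-k)).exp.deriv]
    ring
  rw [hcongr, intervalIntegral.integral_const_mul] at hderiv
  simp only [intervalIntegral.integral_same, mul_zero, Real.exp_zero] at hderiv
  rw [eq_div_iff hk]
  linarith

open Set in
/-- A function that is concave on `[0, c]`, convex on `[c, ∞)` and lies above its tangent line at
`ν ≥ c` at the origin lies above this tangent line everywhere on `[0, ∞)`. -/
theorem tangent_le_of_concaveOn_of_convexOn {g : ℝ → ℝ} {c ν m z : ℝ} (hc : 0 ≤ c)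
    (hconc : ConcaveOn ℝ (Icc 0 c) g) (hconv : ConvexOn ℝ (Ici c) g) (hν : c ≤ ν)
    (hm : HasDerivAt g m ν) (h0 : g ν - m * ν ≤ g 0) (hz : 0 ≤ z) :
    g ν + m * (z - ν) ≤ g z := by
  have right : ∀ y, c ≤ y → g ν + m * (y - ν) ≤ g y := by
    intro y hy
    rcases lt_trichotomy y ν with hlt | rfl | hlt
    · have := hconv.slope_le_of_hasDerivAt hy hν hlt hm
      rw [slope_def_field, div_le_iff₀ (by linarith)] at this
      linarith
    · simp
    · have := hconv.le_slope_of_hasDerivAt hν hy hlt hm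
      rw [slope_def_field, le_div_iff₀ (by linarith)] at this
      linarith
  rcases le_total c z with hcz | hcz
  · exact right z hcz
  rcases hc.eq_or_lt with rfl | hc
  · exact right z hz
  have h1 : 0 ≤ 1 - z / c := by rw [sub_nonneg, div_le_one hc]; exact hcz
  have h2 : 0 ≤ z / c := by positivity
  have key := hconc.2 (left_mem_Icc.2 hc.le) (right_mem_Icc.2 hc.le) h1 h2 (by ring)
  have hzc : z / c * c = z := by field_simp
  simp only [smul_eq_mul, mul_zero, zero_add, hzc] at key
  have h3 := mul_le_mul_of_nonneg_left h0 h1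
  have h4 := mul_le_mul_of_nonneg_left (right c le_rfl) h2
  have h5 : m * (z / c * c) = m * z := by rw [hzc]
  linarith

/-- Any admissible strategy's deterministic proceeds are at most
`(1 − e^{−h(ν)x})/h(ν)`. -/
theorem vwap_value_upper_bound
(g h : ℝ → ℝ) (ζ₀ μ : ℝ)
    (hg_cont : ContinuousOn g (Set.Ici 0))
    (hg0 : g 0 = 0)
    (hg_nonneg : ∀ x, 0 ≤ x → 0 ≤ g x)
    (hg_deriv : ∀ x, 0 < x → HasDerivAt g (h x) x)
    (hh_cont : ContinuousOn h (Set.Ioi 0))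
    (hh_nonneg : ∀ x, 0 < x → 0 ≤ h x)
    (hζ₀ : 0 ≤ ζ₀)
    (hh_anti : ∀ a b, 0 < a → a ≤ b → b ≤ ζ₀ → h b ≤ h a)
    (hh_mono : ∀ a b, ζ₀ ≤ a → 0 < a → a < b → h a < h b)
    (hh_tendsto : Filter.Tendsto h Filter.atTop Filter.atTop)
    (hμ : μ < 0)
(ν : ℝ) (hν_pos : 0 < ν) (hν_ge : ζ₀ ≤ ν)
    (hν_eq : ν * h ν - g ν = -μ) (hhν_pos : 0 < h ν)
    (θ x : ℝ) (hθ : 0 < θ) (hx : 0 ≤ x)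
    (a : ℝ → ℝ) (ha_meas : Measurable a)
    (ha_bdd : ∃ C, ∀ s ∈ Set.Icc 0 θ, a s ≤ C)
    (ha_nonneg : ∀ s ∈ Set.Icc 0 θ, 0 ≤ a s)
    (ha_int : (∫ s in (0:ℝ)..θ, a s) ≤ x) :
    (∫ τ in (0:ℝ)..θ, a τ * Real.exp (μ * τ - ∫ s in (0:ℝ)..τ, g (a s))) ≤
      (1 - Real.exp (-(h ν) * x)) / h ν := by
  have hconc : ConcaveOn ℝ (Set.Icc 0 ζ₀) g := by
    refine AntitoneOn.concaveOn_of_deriv (convex_Icc _ _)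
      (hg_cont.mono Set.Icc_subset_Ici_self) ?_ ?_ <;> rw [interior_Icc]
    · exact fun y hy ↦ (hg_deriv y hy.1).differentiableAt.differentiableWithinAt
    · intro y hy z hz hyz
      rw [(hg_deriv y hy.1).deriv, (hg_deriv z hz.1).deriv]
      exact hh_anti y z hy.1 hyz hz.2.le
  have hconv : ConvexOn ℝ (Set.Ici ζ₀) g := by
    refine MonotoneOn.convexOn_of_deriv (convex_Ici _)
      (hg_cont.mono (Set.Ici_subset_Ici.2 hζ₀)) ?_ ?_ <;> rw [interior_Ici]
    · exact fun y hy ↦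
        (hg_deriv y (hζ₀.trans_lt hy)).differentiableAt.differentiableWithinAt
    · intro y hy z hz hyz
      rw [(hg_deriv y (hζ₀.trans_lt hy)).deriv, (hg_deriv z (hζ₀.trans_lt hz)).deriv]
      rcases hyz.eq_or_lt with rfl | hyz
      · exact le_rfl
      · exact (hh_mono y z (le_of_lt hy) (hζ₀.trans_lt hy) hyz).le
  have tangent : ∀ z, 0 ≤ z → h ν * z + μ ≤ g z := fun z hz ↦ by
    have := tangent_le_of_concaveOn_of_convexOn hζ₀ hconc hconv hν_ge (hg_deriv ν hν_pos)
      (by linarith) hz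
    linarith
  obtain ⟨C, hC⟩ := ha_bdd
  have ha_ii : IntervalIntegrable a MeasureTheory.volume 0 θ := by
    rw [intervalIntegrable_iff_integrableOn_Icc_of_le hθ.le]
    refine MeasureTheory.Measure.integrableOn_of_bounded (M := C) measure_Icc_lt_top.ne
      ha_meas.aestronglyMeasurable ?_
    filter_upwards [MeasureTheory.ae_restrict_mem measurableSet_Icc] with s hs
    rw [Real.norm_of_nonneg (ha_nonneg s hs)]
    exact hC s hs
  have hga_ii : IntervalIntegrable (fun s ↦ g (a s)) MeasureTheory.volume 0 θ := by
    obtain ⟨B, hB⟩ := isCompact_Icc.exists_bound_of_continuousOn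
      (hg_cont.mono (Set.Icc_subset_Ici_self : Set.Icc 0 C ⊆ Set.Ici 0))
    have hmeas : Measurable fun s ↦ g (max 0 (a s)) :=
      (hg_cont.comp_continuous (continuous_const.max continuous_id)
        fun y ↦ le_max_left 0 y).measurable.comp ha_meas
    rw [intervalIntegrable_iff_integrableOn_Icc_of_le hθ.le]
    refine MeasureTheory.IntegrableOn.congr_fun (f := fun s ↦ g (max 0 (a s)))
      (MeasureTheory.Measure.integrableOn_of_bounded (M := B) measure_Icc_lt_top.ne
        hmeas.aestronglyMeasurable ?_)
      (fun s hs ↦ by simp only [max_eq_right (ha_nonneg s hs)]) measurableSet_Icc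
    filter_upwards [MeasureTheory.ae_restrict_mem measurableSet_Icc] with s hs
    rw [max_eq_right (ha_nonneg s hs)]
    exact hB _ ⟨ha_nonneg s hs, hC s hs⟩
  have exponent_le : ∀ τ ∈ Set.Icc 0 θ,
      μ * τ - ∫ s in (0:ℝ)..τ, g (a s) ≤ -(h ν) * ∫ s in (0:ℝ)..τ, a s := by
    intro τ hτ
    have hsub : Set.uIcc 0 τ ⊆ Set.uIcc 0 θ :=
      Set.uIcc_subset_uIcc_left (by rwa [Set.uIcc_of_le hθ.le])
    have ha_τ := (ha_ii.mono_set hsub).const_mul (h ν)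
    have := intervalIntegral.integral_mono_on hτ.1 (ha_τ.add intervalIntegrable_const)
      (hga_ii.mono_set hsub) fun s hs ↦ tangent (a s) (ha_nonneg s ⟨hs.1, hs.2.trans hτ.2⟩)
    rw [intervalIntegral.integral_add ha_τ intervalIntegrable_const,
      intervalIntegral.integral_const_mul, intervalIntegral.integral_const] at this
    simp only [sub_zero, smul_eq_mul] at this
    linarith
  have hmajorant : IntervalIntegrable
      (fun τ ↦ a τ * Real.exp (-(h ν) * ∫ s in (0:ℝ)..τ, a s)) MeasureTheory.volume 0 θ := by
    refine ha_ii.mul_continuousOn (Real.continuous_exp.comp_continuousOn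
      (continuousOn_const.mul ?_))
    exact (ha_ii.absolutelyContinuousOnInterval_intervalIntegral Set.left_mem_uIcc).continuousOn
  calc ∫ τ in (0:ℝ)..θ, a τ * Real.exp (μ * τ - ∫ s in (0:ℝ)..τ, g (a s))
      ≤ ∫ τ in (0:ℝ)..θ, a τ * Real.exp (-(h ν) * ∫ s in (0:ℝ)..τ, a s) := by
        rw [intervalIntegral.integral_of_le hθ.le, intervalIntegral.integral_of_le hθ.le]
        refine MeasureTheory.integral_mono_of_nonneg ?_ hmajorant.1 ?_
        all_goals filter_upwards [MeasureTheory.ae_restrict_mem measurableSet_Ioc] with τ hτ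
        all_goals have hτ := Set.Ioc_subset_Icc_self hτ
        · exact mul_nonneg (ha_nonneg τ hτ) (Real.exp_pos _).le
        · exact mul_le_mul_of_nonneg_left (Real.exp_le_exp.2 (exponent_le τ hτ))
            (ha_nonneg τ hτ)
    _ = (1 - Real.exp (-(h ν) * ∫ s in (0:ℝ)..θ, a s)) / h ν :=
        ha_ii.integral_mul_exp_neg_integral hhν_pos.ne'
    _ ≤ (1 - Real.exp (-(h ν) * x)) / h ν := by
        have := mul_le_mul_of_nonneg_left ha_int hhν_pos.le
        gcongr ?_ / _
        exact sub_le_sub_left (Real.exp_le_exp.2 (by linarith)) 1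
end

section
/- (Deterministic reduction of Theorem 1.) Let θ > 0 and 0 ≤ x ≤ ν·θ. Then the supremum, over all bounded Lebesgue measurable a : [0,θ] → [0,∞) with ∫₀^θ a(s) ds ≤ x, of ∫₀^θ a(τ)·exp(μτ − ∫₀^τ g(a(s)) ds) dτ equals (1 − e^{−h(ν)·x})/h(ν), and it is attained by the VWAP strategy a*(τ) = ν·1_{[0, x/ν]}(τ). -/
open MeasureTheory Set

/-- A bounded integrand `a` and its primitive `A` satisfy the change of variables
`∫ a exp (-H A) = (1 - exp (-H A(θ))) / H`. -/
theorem integral_mul_exp_neg_primitive {a : ℝ → ℝ} {H θ C : ℝ} (hH : 0 < H) (hθ : 0 ≤ θ)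
    (hint : IntervalIntegrable a volume 0 θ) (hC : ∀ s ∈ Icc 0 θ, a s ≤ C)
    (h0 : ∀ s ∈ Icc 0 θ, 0 ≤ a s) :
    ∫ τ in (0 : ℝ)..θ, a τ * Real.exp (-(H * ∫ s in (0 : ℝ)..τ, a s)) =
      (1 - Real.exp (-(H * ∫ s in (0 : ℝ)..θ, a s))) / H := by
  set A : ℝ → ℝ := fun τ => ∫ s in (0 : ℝ)..τ, a s
  have hsub : ∀ x ∈ Icc 0 θ, ∀ y ∈ Icc 0 θ, IntervalIntegrable a volume x y := fun x hx y hy =>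
    hint.mono_set (by rw [uIcc_of_le hθ]; exact uIcc_subset_Icc hx hy)
  have h0mem : (0 : ℝ) ∈ Icc 0 θ := ⟨le_rfl, hθ⟩
  have hA0 : ∀ τ ∈ Icc 0 θ, 0 ≤ A τ := fun τ hτ =>
    intervalIntegral.integral_nonneg hτ.1 fun s hs => h0 s ⟨hs.1, hs.2.trans hτ.2⟩
  have hAlip : LipschitzOnWith (Real.toNNReal C) A (Icc 0 θ) := by
    refine LipschitzOnWith.of_dist_le_mul fun x hx y hy => ?_
    have hxy : A x - A y = ∫ s in y..x, a s :=
      intervalIntegral.integral_interval_sub_left (hsub 0 h0mem x hx) (hsub 0 h0mem y hy)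
    rw [Real.dist_eq, Real.dist_eq, hxy]
    refine intervalIntegral.norm_integral_le_of_norm_le_const (E := ℝ) fun s hs => ?_
    have hs' : s ∈ Icc 0 θ := uIcc_subset_Icc hy hx (uIoc_subset_uIcc hs)
    rw [Real.norm_eq_abs, abs_of_nonneg (h0 s hs')]
    exact (hC s hs').trans (Real.le_coe_toNNReal C)
  have hexp : LipschitzOnWith H.toNNReal (fun u : ℝ => Real.exp (-(H * u))) (Ici 0) := by
    refine (convex_Ici (0 : ℝ)).lipschitzOnWith_of_nnnorm_hasDerivWithin_le
      (f' := fun u => Real.exp (-(H * u)) * -H) (fun u _ => ?_) fun u hu => ?_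
    · simpa using ((((hasDerivAt_id u).const_mul H).neg).exp).hasDerivWithinAt
    · rw [← NNReal.coe_le_coe, coe_nnnorm, Real.coe_toNNReal _ hH.le, norm_mul, norm_neg,
        Real.norm_of_nonneg (Real.exp_nonneg _), Real.norm_of_nonneg hH.le]
      have : Real.exp (-(H * u)) ≤ 1 := Real.exp_le_one_iff.2 (by
        have := mul_nonneg hH.le hu
        linarith)
      nlinarith
  have hac : AbsolutelyContinuousOnInterval (fun τ => Real.exp (-(H * A τ))) 0 θ := by
    refine LipschitzOnWith.absolutelyContinuousOnInterval (K := H.toNNReal * C.toNNReal) ?_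
    rw [uIcc_of_le hθ]
    exact hexp.comp hAlip hA0
  have hFTC := hac.integral_deriv_eq_sub
  have hae : ∫ τ in (0 : ℝ)..θ, deriv (fun τ => Real.exp (-(H * A τ))) τ =
      ∫ τ in (0 : ℝ)..θ, -H * (a τ * Real.exp (-(H * A τ))) := by
    refine intervalIntegral.integral_congr_ae ?_
    filter_upwards [hint.ae_hasDerivAt_integral] with τ hτ hmem
    have := hτ (uIoc_subset_uIcc hmem) 0 left_mem_uIcc
    rw [((this.const_mul H).fun_neg.exp).deriv]
    ring
  rw [hae, intervalIntegral.integral_const_mul] at hFTC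
  have hA00 : A 0 = 0 := intervalIntegral.integral_same
  rw [hA00, mul_zero, neg_zero, Real.exp_zero] at hFTC
  rw [eq_div_iff hH.ne']
  linarith

/-- For an impact function whose derivative is first non-increasing and then increasing, the
tangent at `ν` of intercept `μ` lies below `g` when `μ ≤ 0`. -/
theorem tangent_le_of_concave_then_convex {g h : ℝ → ℝ} {ζ₀ μ ν : ℝ}
    (hg_cont : ContinuousOn g (Ici 0)) (hg0 : g 0 = 0)
    (hg_deriv : ∀ x, 0 < x → HasDerivAt g (h x) x) (hζ₀ : 0 ≤ ζ₀)
    (hh_anti : ∀ a b, 0 < a → a ≤ b → b ≤ ζ₀ → h b ≤ h a)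
    (hh_mono : ∀ a b, ζ₀ ≤ a → 0 < a → a < b → h a < h b)
    (hμ : μ ≤ 0) (hν_pos : 0 < ν) (hν_ge : ζ₀ ≤ ν) (hν_eq : ν * h ν - g ν = -μ)
    {a : ℝ} (ha : 0 ≤ a) : h ν * a + μ ≤ g a := by
  set φ : ℝ → ℝ := fun a => g a - h ν * a with hφ
  have hφ_cont : ContinuousOn φ (Ici 0) := by fun_prop
  have hφ_deriv : ∀ x, 0 < x → HasDerivAt φ (h x - h ν) x := fun x hx => by
    simpa using (hg_deriv x hx).fun_sub ((hasDerivAt_id x).const_mul (h ν))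
  have hφν : φ ν = μ := by simp only [hφ]; linarith
  have hconvex : ∀ b, ζ₀ ≤ b → μ ≤ φ b := by
    intro b hb
    rw [← hφν]
    rcases le_total b ν with hbν | hbν
    · refine antitoneOn_of_deriv_nonpos (convex_Icc ζ₀ ν)
        (hφ_cont.mono fun x hx => hζ₀.trans hx.1) (fun x hx => ?_) (fun x hx => ?_)
        ⟨hb, hbν⟩ ⟨hν_ge, le_rfl⟩ hbν <;> rw [interior_Icc] at hx
      · exact (hφ_deriv x (hζ₀.trans_lt hx.1)).differentiableAt.differentiableWithinAt
      · have hx0 := hζ₀.trans_lt hx.1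
        rw [(hφ_deriv x hx0).deriv]
        linarith [hh_mono x ν hx.1.le hx0 hx.2]
    · refine monotoneOn_of_deriv_nonneg (convex_Ici ν)
        (hφ_cont.mono fun x hx => hν_pos.le.trans hx) (fun x hx => ?_) (fun x hx => ?_)
        self_mem_Ici hbν hbν <;> rw [interior_Ici] at hx
      · exact (hφ_deriv x (hν_pos.trans hx)).differentiableAt.differentiableWithinAt
      · rw [(hφ_deriv x (hν_pos.trans hx)).deriv]
        linarith [hh_mono ν x hν_ge hν_pos hx]
  suffices μ ≤ φ a by simp only [hφ] at this; linarith
  rcases le_total ζ₀ a with h1 | h1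
  · exact hconvex a h1
  have hconc : ConcaveOn ℝ (Icc 0 ζ₀) φ := by
    refine AntitoneOn.concaveOn_of_deriv (convex_Icc 0 ζ₀)
      (hφ_cont.mono fun x hx => hx.1) (fun x hx => ?_) (fun x hx y hy hxy => ?_) <;>
      rw [interior_Icc] at hx
    · exact (hφ_deriv x hx.1).differentiableAt.differentiableWithinAt
    · rw [interior_Icc] at hy
      rw [(hφ_deriv x hx.1).deriv, (hφ_deriv y hy.1).deriv]
      linarith [hh_anti x y hx.1 hxy hy.2.le]
  have hmin := hconc.ge_on_segment (x := 0) (y := ζ₀) ⟨le_rfl, hζ₀⟩ ⟨hζ₀, le_rfl⟩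
    (z := a) (by rw [segment_eq_Icc hζ₀]; exact ⟨ha, h1⟩)
  refine (le_min ?_ (hconvex ζ₀ le_rfl)).trans hmin
  simpa [hφ, hg0] using hμ

/-- A measurable function with values in `[0, C]` on `[0, θ]` stays interval integrable after
composition with a function continuous on `[0, ∞)`. -/
theorem intervalIntegrable_comp_of_bounded {g a : ℝ → ℝ} {θ C : ℝ}
    (hg : ContinuousOn g (Ici 0)) (hθ : 0 ≤ θ) (ha : Measurable a)
    (hC : ∀ s ∈ Icc 0 θ, a s ≤ C) (h0 : ∀ s ∈ Icc 0 θ, 0 ≤ a s) :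
    IntervalIntegrable (fun s => g (a s)) volume 0 θ := by
  have hcont : Continuous fun u : ℝ => g (max u 0) :=
    hg.comp_continuous (by fun_prop) fun u => le_max_right u 0
  obtain ⟨M, hM⟩ := isCompact_Icc.exists_bound_of_continuousOn
    (hg.mono (Icc_subset_Ici_self : Icc 0 C ⊆ Ici 0))
  have hbdd : IntervalIntegrable (fun s => g (max (a s) 0)) volume 0 θ := by
    rw [intervalIntegrable_iff_integrableOn_Icc_of_le hθ]
    refine Measure.integrableOn_of_bounded (M := M) measure_Icc_lt_top.ne
      (hcont.measurable.comp ha).aestronglyMeasurable ?_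
    filter_upwards [ae_restrict_mem measurableSet_Icc] with s hs
    rw [max_eq_left (h0 s hs)]
    exact hM _ ⟨h0 s hs, hC s hs⟩
  refine hbdd.congr fun s hs => ?_
  rw [uIoc_of_le hθ] at hs
  simp only [max_eq_left (h0 s ⟨hs.1.le, hs.2⟩)]

/-- Proceeds of selling at the constant rate `ν` up to time `T` and not at all afterwards. -/
theorem integral_constant_rate {g : ℝ → ℝ} {μ ν H T θ : ℝ} (hH : 0 < H) (hν : 0 < ν)
    (hνH : μ - g ν = -(H * ν)) (hT : 0 ≤ T) (hTθ : T ≤ θ) :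
    ∫ τ in (0 : ℝ)..θ, (if τ ≤ T then ν else 0) *
      Real.exp (μ * τ - ∫ s in (0 : ℝ)..τ, g (if s ≤ T then ν else 0)) =
        (1 - Real.exp (-(H * (ν * T)))) / H := by
  set f : ℝ → ℝ := fun τ => (if τ ≤ T then ν else 0) *
    Real.exp (μ * τ - ∫ s in (0 : ℝ)..τ, g (if s ≤ T then ν else 0))
  have hind : ∫ τ in (0 : ℝ)..θ, f τ = ∫ τ in (0 : ℝ)..T, f τ := by
    rw [intervalIntegral.integral_of_le (hT.trans hTθ), intervalIntegral.integral_of_le hT]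
    refine setIntegral_eq_of_subset_of_forall_sdiff_eq_zero measurableSet_Ioc
      (Ioc_subset_Ioc_right hTθ) fun τ hτ => ?_
    have : ¬ τ ≤ T := fun h => hτ.2 ⟨hτ.1.1, h⟩
    simp [f, this]
  have hconst : ∫ τ in (0 : ℝ)..T, f τ =
      ∫ τ in (0 : ℝ)..T, ν * Real.exp (-(H * ∫ _ in (0 : ℝ)..τ, ν)) := by
    refine intervalIntegral.integral_congr fun τ hτ => ?_
    rw [uIcc_of_le hT] at hτ
    have hg : ∫ s in (0 : ℝ)..τ, g (if s ≤ T then ν else 0) = ∫ _ in (0 : ℝ)..τ, g ν := by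
      refine intervalIntegral.integral_congr fun s hs => ?_
      rw [uIcc_of_le hτ.1] at hs
      simp [hs.2.trans hτ.2]
    simp only [f, hg, if_pos hτ.2, intervalIntegral.integral_const, smul_eq_mul, sub_zero]
    congr 2
    linear_combination τ * hνH
  rw [hind, hconst, integral_mul_exp_neg_primitive (C := ν) hH hT (by simp) (fun _ _ => le_rfl)
    fun _ _ => hν.le]
  simp [mul_comm]

/-- Deterministic reduction of Theorem 1: the supremum of the proceeds over all
admissible strategies equals `(1 − e^{−h(ν)x})/h(ν)`, attained by the VWAP
strategy `a*(τ) = ν·1_{[0,x/ν]}(τ)`. -/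
theorem vwap_theorem_one
(g h : ℝ → ℝ) (ζ₀ μ : ℝ)
    (hg_cont : ContinuousOn g (Set.Ici 0))
    (hg0 : g 0 = 0)
    (hg_nonneg : ∀ x, 0 ≤ x → 0 ≤ g x)
    (hg_deriv : ∀ x, 0 < x → HasDerivAt g (h x) x)
    (hh_cont : ContinuousOn h (Set.Ioi 0))
    (hh_nonneg : ∀ x, 0 < x → 0 ≤ h x)
    (hζ₀ : 0 ≤ ζ₀)
    (hh_anti : ∀ a b, 0 < a → a ≤ b → b ≤ ζ₀ → h b ≤ h a)
    (hh_mono : ∀ a b, ζ₀ ≤ a → 0 < a → a < b → h a < h b)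
    (hh_tendsto : Filter.Tendsto h Filter.atTop Filter.atTop)
    (hμ : μ < 0)
(ν : ℝ) (hν_pos : 0 < ν) (hν_ge : ζ₀ ≤ ν)
    (hν_eq : ν * h ν - g ν = -μ) (hhν_pos : 0 < h ν)
    (θ x : ℝ) (hθ : 0 < θ) (hx0 : 0 ≤ x) (hx : x ≤ ν * θ) :
    IsGreatest {r : ℝ | ∃ a : ℝ → ℝ, Measurable a ∧
        (∃ C, ∀ s ∈ Set.Icc 0 θ, a s ≤ C) ∧
        (∀ s ∈ Set.Icc 0 θ, 0 ≤ a s) ∧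
        (∫ s in (0:ℝ)..θ, a s) ≤ x ∧
        r = ∫ τ in (0:ℝ)..θ, a τ * Real.exp (μ * τ - ∫ s in (0:ℝ)..τ, g (a s))}
      ((1 - Real.exp (-(h ν) * x)) / h ν) ∧
    (∫ τ in (0:ℝ)..θ, (if τ ≤ x / ν then ν else 0) *
        Real.exp (μ * τ - ∫ s in (0:ℝ)..τ, g (if s ≤ x / ν then ν else 0))) =
      (1 - Real.exp (-(h ν) * x)) / h ν := by
  have hval := integral_constant_rate (g := g) (μ := μ) (T := x / ν) (θ := θ) hhν_pos hν_pos
    (by linarith) (by positivity) (by rw [div_le_iff₀ hν_pos]; linarith)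
  rw [mul_div_cancel₀ _ hν_pos.ne', ← neg_mul] at hval
  refine ⟨⟨⟨fun τ => if τ ≤ x / ν then ν else 0, ?_, ⟨ν, fun s _ => ?_⟩, fun s _ => ?_, ?_,
    hval.symm⟩, ?_⟩, hval⟩
  · exact Measurable.ite measurableSet_Iic measurable_const measurable_const
  · dsimp only
    split_ifs <;> linarith
  · dsimp only
    split_ifs <;> linarith
  · have hT : 0 ≤ x / ν := by positivity
    have hTθ : x / ν ≤ θ := by rw [div_le_iff₀ hν_pos]; linarith
    have hind : ∫ s in (0 : ℝ)..θ, (if s ≤ x / ν then ν else 0) = ∫ _ in (0 : ℝ)..(x / ν), ν := by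
      rw [intervalIntegral.integral_of_le hθ.le, intervalIntegral.integral_of_le hT,
        setIntegral_eq_of_subset_of_forall_sdiff_eq_zero measurableSet_Ioc
          (Ioc_subset_Ioc_right hTθ) (f := fun s => if s ≤ x / ν then ν else 0)
          fun s hs => if_neg fun h => hs.2 ⟨hs.1.1, h⟩]
      exact setIntegral_congr_fun measurableSet_Ioc fun s hs => if_pos hs.2
    rw [hind, intervalIntegral.integral_const, smul_eq_mul, sub_zero, div_mul_cancel₀ _ hν_pos.ne']
  · rintro r ⟨a, ha, ⟨C, hC⟩, h0, hax, rfl⟩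
    have hga := intervalIntegrable_comp_of_bounded hg_cont hθ.le ha hC h0
    have hint : IntervalIntegrable a volume 0 θ :=
      intervalIntegrable_comp_of_bounded (g := id) continuousOn_id hθ.le ha hC h0
    have hprim : ∀ {f : ℝ → ℝ}, IntervalIntegrable f volume 0 θ →
        ContinuousOn (fun τ => ∫ s in (0 : ℝ)..τ, f s) (uIcc 0 θ) := fun hf =>
      intervalIntegral.continuousOn_primitive_interval' hf left_mem_uIcc
    have hga_prim := hprim hga
    have ha_prim := hprim hint
    have hexponent : ∀ τ ∈ Icc 0 θ, μ * τ - ∫ s in (0 : ℝ)..τ, g (a s) ≤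
        -(h ν * ∫ s in (0 : ℝ)..τ, a s) := by
      intro τ hτ
      have hsub : uIcc 0 τ ⊆ uIcc 0 θ := by
        rw [uIcc_of_le hτ.1, uIcc_of_le hθ.le]; exact Icc_subset_Icc_right hτ.2
      have ha' := (hint.mono_set hsub).const_mul (h ν)
      have hle := intervalIntegral.integral_mono_on hτ.1 (ha'.add (intervalIntegrable_const (c := μ)))
        (hga.mono_set hsub) fun s hs =>
          tangent_le_of_concave_then_convex hg_cont hg0 hg_deriv hζ₀ hh_anti hh_mono hμ.le hν_pos
            hν_ge hν_eq (h0 s ⟨hs.1, hs.2.trans hτ.2⟩)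
      rw [intervalIntegral.integral_add ha' intervalIntegrable_const,
        intervalIntegral.integral_const_mul, intervalIntegral.integral_const, smul_eq_mul] at hle
      linarith
    calc ∫ τ in (0 : ℝ)..θ, a τ * Real.exp (μ * τ - ∫ s in (0 : ℝ)..τ, g (a s))
        ≤ ∫ τ in (0 : ℝ)..θ, a τ * Real.exp (-(h ν * ∫ s in (0 : ℝ)..τ, a s)) := by
          refine intervalIntegral.integral_mono_on hθ.le (hint.mul_continuousOn (by fun_prop))
            (hint.mul_continuousOn (by fun_prop)) fun τ hτ => ?_
          exact mul_le_mul_of_nonneg_left (Real.exp_le_exp.2 (hexponent τ hτ)) (h0 τ hτ)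
      _ = (1 - Real.exp (-(h ν * ∫ s in (0 : ℝ)..θ, a s))) / h ν :=
          integral_mul_exp_neg_primitive hhν_pos hθ.le hint hC h0
      _ ≤ (1 - Real.exp (-(h ν) * x)) / h ν := by
          have := mul_le_mul_of_nonneg_left hax hhν_pos.le
          gcongr
          linarith
end

section
/- Let θ > 0, x ≥ 0, and let a : [0,θ] → [0,∞) be bounded and Lebesgue measurable with ∫₀^θ a(s) ds ≤ x. Then ∫₀^θ a(τ)·exp(∫₀^τ (1 + a(s))·(μ − ĝ(a(s)/(1+a(s)))) ds) dτ ≤ (1 − e^{−ĥ(ν̂)·x})/ĥ(ν̂). -/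
open MeasureTheory Set

/-- Post-composing an absolutely continuous real function with a `C¹` function preserves absolute
continuity. -/
theorem ContDiff.comp_absolutelyContinuousOnInterval {f φ : ℝ → ℝ} {a b : ℝ}
    (hφ : ContDiff ℝ 1 φ) (hf : AbsolutelyContinuousOnInterval f a b) :
    AbsolutelyContinuousOnInterval (fun x => φ (f x)) a b := by
  obtain ⟨M, hM⟩ := hf.exists_bound
  obtain ⟨K, hK⟩ := hφ.contDiffOn.exists_lipschitzOnWith one_ne_zero
    (convex_Icc (-M) M) isCompact_Icc
  have hmem : ∀ x ∈ uIcc a b, f x ∈ Icc (-M) M := fun x hx => abs_le.1 (hM x hx)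
  rw [absolutelyContinuousOnInterval_iff] at hf ⊢
  intro ε hε
  obtain ⟨δ, hδ, h⟩ := hf (ε / (K + 1)) (by positivity)
  refine ⟨δ, hδ, fun E hE hEδ => ?_⟩
  have hsum := h E hE hEδ
  rw [lt_div_iff₀ (by positivity)] at hsum
  refine lt_of_le_of_lt ?_ hsum
  rw [Finset.sum_mul]
  refine Finset.sum_le_sum fun i hi => ?_
  have hd := hK.dist_le_mul _ (hmem _ (hE.1 i hi).1) _ (hmem _ (hE.1 i hi).2)
  nlinarith [dist_nonneg (x := f (E.2 i).1) (y := f (E.2 i).2)]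

theorem intervalIntegral_mul_exp_neg_mul_primitive {a : ℝ → ℝ} {θ c : ℝ} (hc : c ≠ 0)
    (ha : IntervalIntegrable a volume 0 θ) :
    ∫ τ in (0 : ℝ)..θ, a τ * Real.exp (-c * ∫ s in (0 : ℝ)..τ, a s) =
      (1 - Real.exp (-c * ∫ s in (0 : ℝ)..θ, a s)) / c := by
  have hac := ContDiff.comp_absolutelyContinuousOnInterval (φ := fun y => -Real.exp (-c * y) / c)
    (by fun_prop) (ha.absolutelyContinuousOnInterval_intervalIntegral left_mem_uIcc)
  have hftc := hac.integral_deriv_eq_sub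
  have hderiv : ∫ τ in (0 : ℝ)..θ, a τ * Real.exp (-c * ∫ s in (0 : ℝ)..τ, a s) =
      ∫ τ in (0 : ℝ)..θ, deriv (fun x => -Real.exp (-c * ∫ s in (0 : ℝ)..x, a s) / c) τ := by
    refine intervalIntegral.integral_congr_ae ?_
    filter_upwards [ha.ae_hasDerivAt_integral] with τ hτ hmem
    have hA := hτ (uIoc_subset_uIcc hmem) 0 left_mem_uIcc
    refine (HasDerivAt.deriv ?_).symm
    convert! ((hA.const_mul (-c)).exp.neg.div_const c) using 1
    field_simp
  rw [hderiv, hftc]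
  simp only [intervalIntegral.integral_same, mul_zero, Real.exp_zero]
  ring

/-- A function which is concave up to `ζ`, convex afterwards, and lies above its tangent line
at `ν ≥ ζ` at the origin, lies above this tangent line on all of `[0, 1)`. -/
theorem tangent_le_of_antitone_monotone_deriv {g h : ℝ → ℝ} {ζ ν : ℝ}
    (hg : ContinuousOn g (Ico 0 1))
    (hderiv : ∀ b, 0 < b → b < 1 → HasDerivAt g (h b) b)
    (hζ : 0 ≤ ζ) (hν0 : 0 < ν) (hζν : ζ ≤ ν) (hν : ν < 1)
    (hanti : AntitoneOn h (Ioc 0 ζ)) (hmono : MonotoneOn h (Ico ζ 1 ∩ Ioi 0))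
    (hzero : g ν - ν * h ν ≤ g 0) {b : ℝ} (hb : b ∈ Ico (0 : ℝ) 1) :
    g ν + h ν * (b - ν) ≤ g b := by
  have hcont : ContinuousOn (fun y => g y - h ν * y) (Ico 0 1) := by fun_prop
  have hd : ∀ y, 0 < y → y < 1 → HasDerivAt (fun y => g y - h ν * y) (h y - h ν) y := by
    intro y hy hy'
    convert! (hderiv y hy hy').sub ((hasDerivAt_id y).const_mul (h ν)) using 1
    rw [mul_one]
  have hleft : AntitoneOn (fun y => g y - h ν * y) (Icc ζ ν) := by
    refine antitoneOn_of_deriv_nonpos (convex_Icc _ _)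
      (hcont.mono fun y hy => ⟨hζ.trans hy.1, hy.2.trans_lt hν⟩) ?_ ?_ <;>
      rw [interior_Icc] <;> rintro y ⟨hy, hy'⟩ <;>
      have hD := hd y (hζ.trans_lt hy) (hy'.trans hν)
    · exact hD.differentiableAt.differentiableWithinAt
    · rw [hD.deriv, sub_nonpos]
      exact hmono ⟨⟨hy.le, hy'.trans hν⟩, hζ.trans_lt hy⟩
        ⟨⟨hζν, hν⟩, (hζ.trans_lt hy).trans hy'⟩ hy'.le
  have hright : MonotoneOn (fun y => g y - h ν * y) (Ico ν 1) := by
    refine monotoneOn_of_deriv_nonneg (convex_Ico _ _)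
      (hcont.mono (Ico_subset_Ico_left hν0.le)) ?_ ?_ <;>
      rw [interior_Ico] <;> rintro y ⟨hy, hy'⟩ <;>
      have hD := hd y (hν0.trans hy) hy'
    · exact hD.differentiableAt.differentiableWithinAt
    · rw [hD.deriv, sub_nonneg]
      exact hmono ⟨⟨hζν, hν⟩, hν0⟩ ⟨⟨hζν.trans hy.le, hy'⟩, hν0.trans hy⟩ hy.le
  rcases le_total ν b with hνb | hbν
  · have := hright ⟨le_rfl, hν⟩ ⟨hνb, hb.2⟩ hνb
    simp only at this
    linarith
  rcases le_total ζ b with hζb | hbζ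
  · have := hleft ⟨hζb, hbν⟩ ⟨hζν, le_rfl⟩ hbν
    simp only at this
    linarith
  have hζ' := hleft ⟨le_rfl, hζν⟩ ⟨hζν, le_rfl⟩ hζν
  simp only at hζ'
  rcases hb.1.eq_or_lt with rfl | hb0
  · linarith
  have hζ0 : 0 < ζ := hb0.trans_le hbζ
  have hconc : ConcaveOn ℝ (Icc 0 ζ) g := by
    have hD : ∀ y ∈ Ioo 0 ζ, HasDerivAt g (h y) y := fun y hy =>
      hderiv y hy.1 (hy.2.trans_le hζν |>.trans hν)
    refine AntitoneOn.concaveOn_of_deriv (convex_Icc _ _)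
      (hg.mono fun y hy => ⟨hy.1, (hy.2.trans hζν).trans_lt hν⟩) ?_ ?_ <;> rw [interior_Icc]
    · exact fun y hy => (hD y hy).differentiableAt.differentiableWithinAt
    · intro y hy z hz hyz
      rw [(hD y hy).deriv, (hD z hz).deriv]
      exact hanti ⟨hy.1, hy.2.le⟩ ⟨hz.1, hz.2.le⟩ hyz
  have ht : b / ζ ≤ 1 := (div_le_one hζ0).2 hbζ
  have ht0 : 0 ≤ b / ζ := by positivity
  have hcomb := hconc.2 ⟨le_rfl, hζ⟩ ⟨hζ, le_rfl⟩ (sub_nonneg.2 ht) ht0 (sub_add_cancel _ _)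
  have hbeq : b / ζ * ζ = b := div_mul_cancel₀ _ hζ0.ne'
  simp only [smul_eq_mul, mul_zero, zero_add, hbeq] at hcomb
  have h1 := mul_le_mul_of_nonneg_left hzero (sub_nonneg.2 ht)
  have h2 := mul_le_mul_of_nonneg_left hζ' ht0
  have h3 : h ν * (b / ζ * ζ) = h ν * b := by rw [hbeq]
  linarith

theorem intervalIntegrable_of_measurable_of_bound {f : ℝ → ℝ} {a b C : ℝ} (hf : Measurable f)
    (hC : ∀ s ∈ uIcc a b, |f s| ≤ C) : IntervalIntegrable f volume a b := by
  rw [intervalIntegrable_iff]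
  refine IntegrableOn.of_bound (by simp [uIoc]) hf.aestronglyMeasurable C ?_
  exact (ae_restrict_iff' measurableSet_uIoc).2 (.of_forall fun s hs => hC s (uIoc_subset_uIcc hs))

theorem div_one_add_mem_Icc {y C : ℝ} (hy : 0 ≤ y) (hyC : y ≤ C) :
    y / (1 + y) ∈ Icc 0 (C / (1 + C)) := by
  refine ⟨by positivity, ?_⟩
  rw [div_le_div_iff₀ (by linarith) (by linarith)]
  linarith

theorem intervalIntegrable_one_add_mul_sub {g a : ℝ → ℝ} {μ θ C : ℝ}
    (hg : ContinuousOn g (Ico 0 1)) (hθ : 0 ≤ θ) (ha : Measurable a)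
    (ha_nonneg : ∀ s ∈ Icc 0 θ, 0 ≤ a s) (haC : ∀ s ∈ Icc 0 θ, a s ≤ C) :
    IntervalIntegrable (fun s => (1 + a s) * (μ - g (a s / (1 + a s)))) volume 0 θ := by
  classical
  have hC : 0 ≤ C := (ha_nonneg 0 ⟨le_rfl, hθ⟩).trans (haC 0 ⟨le_rfl, hθ⟩)
  have hC1 : C / (1 + C) < 1 := by rw [div_lt_one (by linarith)]; linarith
  have hsub : Icc 0 (C / (1 + C)) ⊆ Ico (0 : ℝ) 1 := Icc_subset_Ico_right hC1
  have hmem : ∀ s ∈ Icc 0 θ, a s / (1 + a s) ∈ Icc 0 (C / (1 + C)) := fun s hs =>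
    div_one_add_mem_Icc (ha_nonneg s hs) (haC s hs)
  obtain ⟨M, hM⟩ := isCompact_Icc.exists_bound_of_continuousOn (hg.mono hsub)
  have hmeas : Measurable ((Ico (0 : ℝ) 1).piecewise g 0) :=
    hg.measurable_piecewise continuousOn_const measurableSet_Ico
  have heq : ∀ s ∈ Icc 0 θ,
      (Ico (0 : ℝ) 1).piecewise g 0 (a s / (1 + a s)) = g (a s / (1 + a s)) :=
    fun s hs => piecewise_eq_of_mem _ _ _ (hsub (hmem s hs))
  have hint : IntervalIntegrable
      (fun s => (1 + a s) * (μ - (Ico (0 : ℝ) 1).piecewise g 0 (a s / (1 + a s))))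
      volume 0 θ := by
    refine intervalIntegrable_of_measurable_of_bound (C := (1 + C) * (|μ| + M)) ?_ ?_
    · exact (ha.const_add 1).mul
        ((hmeas.comp (ha.div (ha.const_add 1))).const_sub μ)
    · rw [uIcc_of_le hθ]
      intro s hs
      rw [heq s hs, abs_mul]
      have h1 : |1 + a s| ≤ 1 + C := by
        rw [abs_of_nonneg (by linarith [ha_nonneg s hs])]
        linarith [haC s hs]
      exact mul_le_mul h1 ((abs_sub _ _).trans (add_le_add le_rfl (hM _ (hmem s hs))))
        (abs_nonneg _) (by linarith)
  refine hint.congr ?_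
  rw [uIoc_of_le hθ]
  intro s hs
  simp only [heq s (Ioc_subset_Icc_self hs)]


/-- Any admissible strategy's deterministic proceeds in the
self-exciting-volume problem are at most `(1 − e^{−ĥ(ν̂)x})/ĥ(ν̂)`. -/
theorem vwap_hat_value_upper_bound
(gh hh : ℝ → ℝ) (ζ₀ μ : ℝ)
    (hg_cont : ContinuousOn gh (Set.Ico 0 1))
    (hg0 : gh 0 = 0)
    (hg_nonneg : ∀ b, 0 ≤ b → b < 1 → 0 ≤ gh b)
    (hg_deriv : ∀ b, 0 < b → b < 1 → HasDerivAt gh (hh b) b)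
    (hh_cont : ContinuousOn hh (Set.Ioo 0 1))
    (hh_nonneg : ∀ b, 0 < b → b < 1 → 0 ≤ hh b)
    (hζ₀ : 0 ≤ ζ₀) (hζ₀1 : ζ₀ < 1)
    (hh_anti : ∀ b₁ b₂, 0 < b₁ → b₁ ≤ b₂ → b₂ ≤ ζ₀ → hh b₂ ≤ hh b₁)
    (hh_mono : ∀ b₁ b₂, ζ₀ ≤ b₁ → 0 < b₁ → b₁ < b₂ → b₂ < 1 → hh b₁ < hh b₂)
    (hh_tendsto : Filter.Tendsto hh (nhdsWithin 1 (Set.Iio 1)) Filter.atTop)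
    (hμ : μ < 0)
(νh : ℝ) (hνh_pos : 0 < νh) (hνh_lt : νh < 1) (hνh_ge : ζ₀ ≤ νh)
    (hνh_eq : νh * hh νh - gh νh = -μ) (hhνh_pos : 0 < hh νh)
    (θ x : ℝ) (hθ : 0 < θ) (hx : 0 ≤ x)
    (a : ℝ → ℝ) (ha_meas : Measurable a)
    (ha_bdd : ∃ C, ∀ s ∈ Set.Icc 0 θ, a s ≤ C)
    (ha_nonneg : ∀ s ∈ Set.Icc 0 θ, 0 ≤ a s)
    (ha_int : (∫ s in (0:ℝ)..θ, a s) ≤ x) :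
    (∫ τ in (0:ℝ)..θ, a τ *
        Real.exp (∫ s in (0:ℝ)..τ, (1 + a s) * (μ - gh (a s / (1 + a s))))) ≤
      (1 - Real.exp (-(hh νh) * x)) / hh νh := by
  obtain ⟨C, hC⟩ := ha_bdd
  have hI : uIcc 0 θ = Icc 0 θ := uIcc_of_le hθ.le
  have ha : IntervalIntegrable a volume 0 θ := by
    refine intervalIntegrable_of_measurable_of_bound (C := C) ha_meas fun s hs => ?_
    rw [hI] at hs
    rw [abs_of_nonneg (ha_nonneg s hs)]
    exact hC s hs
  have hF := intervalIntegrable_one_add_mul_sub (μ := μ) hg_cont hθ.le ha_meas ha_nonneg hC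
  have hmono : MonotoneOn hh (Ico ζ₀ 1 ∩ Ioi 0) := fun b₁ h₁ b₂ h₂ h => by
    rcases h.eq_or_lt with rfl | h
    · exact le_rfl
    · exact (hh_mono b₁ b₂ h₁.1.1 h₁.2 h h₂.1.2).le
  have hrate : ∀ s ∈ Icc 0 θ,
      (1 + a s) * (μ - gh (a s / (1 + a s))) ≤ -(hh νh) * a s := by
    intro s hs
    have has := ha_nonneg s hs
    have hpos : 0 < 1 + a s := by linarith
    have hb : a s / (1 + a s) ∈ Ico (0 : ℝ) 1 :=
      ⟨by positivity, by rw [div_lt_one hpos]; linarith⟩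
    have htan := tangent_le_of_antitone_monotone_deriv hg_cont hg_deriv hζ₀ hνh_pos hνh_ge hνh_lt
      (fun b₁ h₁ b₂ h₂ h => hh_anti b₁ b₂ h₁.1 h h₂.2) hmono (by linarith) hb
    calc (1 + a s) * (μ - gh (a s / (1 + a s)))
        ≤ (1 + a s) * (-(hh νh) * (a s / (1 + a s))) :=
          mul_le_mul_of_nonneg_left (by linarith) hpos.le
      _ = -(hh νh) * a s := by field_simp
  have hexponent : ∀ τ ∈ Icc 0 θ,
      (∫ s in (0:ℝ)..τ, (1 + a s) * (μ - gh (a s / (1 + a s)))) ≤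
        -(hh νh) * ∫ s in (0:ℝ)..τ, a s := by
    intro τ hτ
    have hsub : uIcc 0 τ ⊆ uIcc 0 θ := by
      rw [hI, uIcc_of_le hτ.1]
      exact Icc_subset_Icc_right hτ.2
    rw [← intervalIntegral.integral_const_mul]
    exact intervalIntegral.integral_mono_on hτ.1 (hF.mono_set hsub)
      ((ha.mono_set hsub).const_mul _) fun s hs => hrate s ⟨hs.1, hs.2.trans hτ.2⟩
  calc _ ≤ ∫ τ in (0:ℝ)..θ, a τ * Real.exp (-(hh νh) * ∫ s in (0:ℝ)..τ, a s) := by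
        refine intervalIntegral.integral_mono_on hθ.le
          (ha.mul_continuousOn (Real.continuous_exp.comp_continuousOn
            (intervalIntegral.continuousOn_primitive_interval' hF left_mem_uIcc)))
          (ha.mul_continuousOn (Real.continuous_exp.comp_continuousOn
            ((intervalIntegral.continuousOn_primitive_interval' ha left_mem_uIcc).const_mul _)))
          fun τ hτ => ?_
        exact mul_le_mul_of_nonneg_left (Real.exp_le_exp.2 (hexponent τ hτ)) (ha_nonneg τ hτ)
    _ = (1 - Real.exp (-(hh νh) * ∫ s in (0:ℝ)..θ, a s)) / hh νh :=
        intervalIntegral_mul_exp_neg_mul_primitive hhνh_pos.ne' ha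
    _ ≤ _ := by
        refine div_le_div_of_nonneg_right (sub_le_sub_left (Real.exp_le_exp.2 ?_) _) hhνh_pos.le
        nlinarith
end
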